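/- arXiv:2005.06690 — 8 statements merged into one kernel-verified Lean document; each statement's English description precedes it below -/
import Mathlib

section
/- Let 𝒜 be an abelian category and f: C' → C a morphism. Then the following are equivalent: (1) f is a projective morphism, i.e. for every object A the induced map Ext¹(f,A): Ext¹(C,A) → Ext¹(C',A) is zero; (2) f factors through every epimorphism B → C ending at C; (3) for every short exact sequence 0 → A → B → C → 0 with extension class δ ∈ Ext¹(C,A), the pullback class f*δ ∈ Ext¹(C',A) is zero. -/
/- Preliminary definitions: the abelian-category instance of the extriangulated
notions of the paper (s-projective/injective morphisms and objects, almost split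
short exact sequences, morphisms determined by objects, etc.). -/

open CategoryTheory CategoryTheory.Limits

attribute [local instance] CategoryTheory.Abelian.hasFiniteBiproducts

universe w v u

variable {𝒜 : Type u} [Category.{v} 𝒜] [Abelian 𝒜]

section ExtDefs

variable [HasExt.{w} 𝒜]

/-- `f : X ⟶ Y` is a projective morphism if `Ext¹(f, A) : Ext¹(Y, A) → Ext¹(X, A)`
is zero for every object `A`. -/
def IsProjMorphism {X Y : 𝒜} (f : X ⟶ Y) : Prop :=
  ∀ (A : 𝒜) (δ : Abelian.Ext Y A 1), (Abelian.Ext.mk₀ f).comp δ (zero_add 1) = 0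

/-- `f : X ⟶ Y` is an injective morphism if `Ext¹(A, f) : Ext¹(A, X) → Ext¹(A, Y)`
is zero for every object `A`. -/
def IsInjMorphism {X Y : 𝒜} (f : X ⟶ Y) : Prop :=
  ∀ (A : 𝒜) (δ : Abelian.Ext A X 1), δ.comp (Abelian.Ext.mk₀ f) (add_zero 1) = 0

/-- An object `P` is (s-)projective when `Ext¹(P, A) = 0` for all `A`. -/
def IsExtProjective (P : 𝒜) : Prop := ∀ (A : 𝒜) (δ : Abelian.Ext P A 1), δ = 0

/-- An object `I` is (s-)injective when `Ext¹(A, I) = 0` for all `A`. -/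
def IsExtInjective (I : 𝒜) : Prop := ∀ (A : 𝒜) (δ : Abelian.Ext A I 1), δ = 0

/-- A short exact sequence `0 → X₁ → X₂ → X₃ → 0` with extension class `η` is
almost split if `η ≠ 0`, the pushout `a_*η` vanishes for every non-section
`a : X₁ ⟶ X'`, and the pullback `c^*η` vanishes for every non-retraction `c : Y' ⟶ X₃`. -/
def IsAlmostSplitSeq {S : ShortComplex 𝒜} (hS : S.ShortExact) : Prop :=
  hS.extClass ≠ 0 ∧
    (∀ (X' : 𝒜) (a : S.X₁ ⟶ X'), ¬ IsSplitMono a →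
      hS.extClass.comp (Abelian.Ext.mk₀ a) (add_zero 1) = 0) ∧
    (∀ (Y' : 𝒜) (c : Y' ⟶ S.X₃), ¬ IsSplitEpi c →
      (Abelian.Ext.mk₀ c).comp hS.extClass (zero_add 1) = 0)

/-- There exists an almost split short exact sequence `0 → A → E → B → 0`. -/
def ExistsAlmostSplitSeq (A B : 𝒜) : Prop :=
  ∃ (E : 𝒜) (i : A ⟶ E) (p : E ⟶ B) (w : i ≫ p = 0)
    (hS : (ShortComplex.mk i p w).ShortExact), IsAlmostSplitSeq hS

/-- There exists an almost split short exact sequence ending at `Y`. -/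
def ExistsAlmostSplitEndingAt (Y : 𝒜) : Prop := ∃ X : 𝒜, ExistsAlmostSplitSeq X Y

/-- There exists an almost split short exact sequence starting at `X`. -/
def ExistsAlmostSplitStartingAt (X : 𝒜) : Prop := ∃ Y : 𝒜, ExistsAlmostSplitSeq X Y

end ExtDefs

/-- `g` factors through `f` (both with target `Y`). -/
def FactorsThru {T X Y : 𝒜} (g : T ⟶ Y) (f : X ⟶ Y) : Prop := ∃ t : T ⟶ X, t ≫ f = g

/-- `f : X ⟶ Y` is right `C`-determined. -/
def RightDetermined (C : 𝒜) {X Y : 𝒜} (f : X ⟶ Y) : Prop :=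
  ∀ (T : 𝒜) (g : T ⟶ Y), (∀ h : C ⟶ T, FactorsThru (h ≫ g) f) → FactorsThru g f

/-- `Y` is a direct summand of `X`. -/
def IsDirectSummand (Y X : 𝒜) : Prop := ∃ (i : Y ⟶ X) (r : X ⟶ Y), i ≫ r = 𝟙 Y

/-- `X` is indecomposable: it is nonzero and in any biproduct decomposition one
of the factors vanishes. -/
def Indec (X : 𝒜) : Prop :=
  ¬ IsZero X ∧ ∀ (A B : 𝒜), Nonempty (X ≅ A ⊞ B) → IsZero A ∨ IsZero B

/-- `h : T ⟶ Z` lies in the radical: for every `u : Z ⟶ T` the composite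
`h ∘ u` lies in the Jacobson radical of `End Z`. -/
def InRadical {T Z : 𝒜} (h : T ⟶ Z) : Prop :=
  ∀ u : Z ⟶ T, (u ≫ h : End Z) ∈ (⊥ : Ideal (End Z)).jacobson

/-- `g : Z ⟶ Y` almost factors through `f : X ⟶ Y`. -/
def AlmostFactorsThru {Z X Y : 𝒜} (g : Z ⟶ Y) (f : X ⟶ Y) : Prop :=
  ¬ FactorsThru g f ∧ ∀ (T : 𝒜) (h : T ⟶ Z), InRadical h → FactorsThru (h ≫ g) f

/-- `y : B ⟶ C` is right almost split. -/
def RightAlmostSplit {B C : 𝒜} (y : B ⟶ C) : Prop :=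
  ¬ IsSplitEpi y ∧ ∀ (B' : 𝒜) (h : B' ⟶ C), ¬ IsSplitEpi h → FactorsThru h y

/-- `f : X ⟶ Y` is right minimal. -/
def RightMinimal {X Y : 𝒜} (f : X ⟶ Y) : Prop := ∀ g : X ⟶ X, g ≫ f = f → IsIso g

/-- A Krull–Schmidt category: every object is a finite biproduct of objects with
local endomorphism rings. -/
def IsKrullSchmidtCat (𝒞 : Type u) [Category.{v} 𝒞] [Abelian 𝒞] : Prop :=
  ∀ X : 𝒞, ∃ (n : ℕ) (Z : Fin n → 𝒞), Nonempty (X ≅ ⨁ Z) ∧ ∀ i, IsLocalRing (End (Z i))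

section Effaceability

/-- A quasi-isomorphism from a complex `K` concentrated in degrees `≤ i` to the single complex
on `X` in degree `i` can be lifted, after passing to an epimorphism `K.X i ⟶ X`. -/
lemma CochainComplex.exists_epi_lift_of_quasiIsoAt_to_single {X : 𝒜} {K : CochainComplex 𝒜 ℤ}
    {i : ℤ} (π : K ⟶ (HomologicalComplex.single 𝒜 (ComplexShape.up ℤ) i).obj X)
    [K.IsStrictlyLE i] [QuasiIsoAt π i] :
    ∃ (B : 𝒜) (p : B ⟶ X) (_ : Epi p)
      (σ : (HomologicalComplex.single 𝒜 (ComplexShape.up ℤ) i).obj B ⟶ K),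
      σ ≫ π = (HomologicalComplex.single 𝒜 (ComplexShape.up ℤ) i).map p := by
  have hK : IsZero (K.X (i + 1)) := K.isZero_of_isStrictlyLE i (i + 1) (by simp)
  let e := K.iCyclesIso i (i + 1) (by simp) (hK.eq_of_tgt _ _)
  let α := e.inv ≫ K.homologyπ i ≫ HomologicalComplex.homologyMap π i ≫
    (HomologicalComplex.singleObjHomologySelfIso _ _ _).hom
  have hα : π.f i = α ≫ (HomologicalComplex.singleObjXSelf (ComplexShape.up ℤ) i X).inv := by
    rw [← cancel_epi e.hom]
    dsimp only [α, e]
    rw [Category.assoc, Category.assoc, Category.assoc,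
      Iso.hom_inv_id_assoc,
      HomologicalComplex.homologyπ_naturality_assoc,
      HomologicalComplex.homologyπ_singleObjHomologySelfIso_hom_assoc,
      ← HomologicalComplex.singleObjCyclesSelfIso_inv_iCycles, Iso.hom_inv_id_assoc,
      HomologicalComplex.iCyclesIso_hom, ← HomologicalComplex.cyclesMap_i]
  have : Epi α := by
    have : IsIso (HomologicalComplex.homologyMap π i) := inferInstance
    exact epi_comp _ _
  refine ⟨K.X i, α, this, HomologicalComplex.mkHomFromSingle (𝟙 _) (fun j hj ↦ ?_), ?_⟩
  · obtain rfl : i + 1 = j := hj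
    exact hK.eq_of_tgt _ _
  · apply HomologicalComplex.from_single_hom_ext
    rw [HomologicalComplex.comp_f, HomologicalComplex.mkHomFromSingle_f, Category.assoc, hα,
      Category.id_comp]
    exact (HomologicalComplex.single_map_f_self ..).symm

lemma DerivedCategory.exists_epi_map_comp_eq_zero [HasDerivedCategory.{w} 𝒜] {X : 𝒜}
    {L : CochainComplex 𝒜 ℤ} {i : ℤ}
    (φ : Q.obj ((CochainComplex.singleFunctor 𝒜 i).obj X) ⟶ Q.obj L)
    (n : ℤ) (hn : n < i) [L.IsStrictlyLE n] :
    ∃ (B : 𝒜) (p : B ⟶ X) (_ : Epi p),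
      Q.map ((CochainComplex.singleFunctor 𝒜 i).map p) ≫ φ = 0 := by
  obtain ⟨K, _, π, h, g, rfl⟩ := right_fac_of_isStrictlyLE φ i
  let π' : K ⟶ (HomologicalComplex.single 𝒜 (ComplexShape.up ℤ) i).obj X := π
  have : QuasiIso π' := (isIso_Q_map_iff_quasiIso 𝒜 π).1 h
  obtain ⟨B, p, hp, σ, hσ⟩ : ∃ (B : 𝒜) (p : B ⟶ X) (_ : Epi p)
      (σ : (CochainComplex.singleFunctor 𝒜 i).obj B ⟶ K),
      σ ≫ π = (CochainComplex.singleFunctor 𝒜 i).map p :=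
    CochainComplex.exists_epi_lift_of_quasiIsoAt_to_single π'
  have hσg : σ ≫ g = 0 := by
    apply HomologicalComplex.from_single_hom_ext
    apply (L.isZero_of_isStrictlyLE n i hn).eq_of_tgt
  refine ⟨B, p, hp, ?_⟩
  rw [← hσ, Q.map_comp, Category.assoc, IsIso.hom_inv_id_assoc, ← Q.map_comp, hσg, Q.map_zero]

/-- `Ext` in positive degrees is effaceable in the first variable. -/
lemma CategoryTheory.Abelian.Ext.exists_epi_mk₀_comp_eq_zero [HasExt.{w} 𝒜] {X Y : 𝒜} {n : ℕ}
    (e : Ext X Y (n + 1)) :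
    ∃ (B : 𝒜) (p : B ⟶ X) (_ : Epi p), (mk₀ p).comp e (zero_add _) = 0 := by
  let := HasDerivedCategory.standard 𝒜
  let iso := ((DerivedCategory.singleFunctors 𝒜).shiftIso (n + 1) (-(n + 1)) 0 (by lia)).app Y
  obtain ⟨B, p, hp, h⟩ := DerivedCategory.exists_epi_map_comp_eq_zero
    (L := (CochainComplex.singleFunctor 𝒜 (-(n + 1))).obj Y) (i := 0) (X := X)
    (e.hom ≫ iso.hom) (-(n + 1)) (by lia)
  refine ⟨B, p, hp, ?_⟩
  ext
  rw [comp_hom, mk₀_hom, ShiftedHom.mk₀_comp, zero_hom, ← cancel_mono iso.hom,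
    Category.assoc, Limits.zero_comp]
  exact h

end Effaceability

/-- characterizations of projective morphisms in an abelian category. -/
theorem statement_0 [HasExt.{w} 𝒜] {C' C : 𝒜} (f : C' ⟶ C) :
    List.TFAE [
      IsProjMorphism f,
      ∀ (B : 𝒜) (p : B ⟶ C), Epi p → FactorsThru f p,
      ∀ (A B : 𝒜) (i : A ⟶ B) (p : B ⟶ C) (w : i ≫ p = 0)
        (hS : (ShortComplex.mk i p w).ShortExact),
        (Abelian.Ext.mk₀ f).comp hS.extClass (zero_add 1) = 0] := by
  tfae_have 1 → 3 := fun h A B i p w hS ↦ h A hS.extClass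
  tfae_have 3 → 2 := fun h B p _ ↦ by
    have hS : (ShortComplex.mk _ _ (kernel.condition p)).ShortExact :=
      { exact := ShortComplex.exact_of_f_is_kernel _ (kernelIsKernel p) }
    obtain ⟨t, ht⟩ := Abelian.Ext.covariant_sequence_exact₃ C' hS (Abelian.Ext.mk₀ f)
      (zero_add 1) (h _ _ _ _ _ hS)
    obtain ⟨t, rfl⟩ := (Abelian.Ext.mk₀_bijective _ _).2 t
    exact ⟨t, (Abelian.Ext.mk₀_bijective _ _).1 (by simpa using ht)⟩
  tfae_have 2 → 1 := fun h A δ ↦ by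
    obtain ⟨B, p, hp, hδ⟩ := δ.exists_epi_mk₀_comp_eq_zero
    obtain ⟨t, rfl⟩ := h B p hp
    rw [← Abelian.Ext.mk₀_comp_mk₀_assoc, hδ, Abelian.Ext.comp_zero]
  tfae_finish
end

section
/- Let 𝒜 be an abelian category, α: X → Y an epimorphism, and f: T → Y a morphism. Then f factors through α if and only if there exists a morphism g: T → X such that f − α∘g is a projective morphism. -/
/- Preliminary definitions: the abelian-category instance of the extriangulated
notions of the paper (s-projective/injective morphisms and objects, almost split
short exact sequences, morphisms determined by objects, etc.). -/

open CategoryTheory CategoryTheory.Limits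

attribute [local instance] CategoryTheory.Abelian.hasFiniteBiproducts

universe w v u

variable {𝒜 : Type u} [Category.{v} 𝒜] [Abelian 𝒜]

/-- An epimorphism together with its kernel forms a short exact sequence. -/
lemma shortExact_kernel {X Y : 𝒜} (α : X ⟶ Y) [Epi α] :
    (ShortComplex.mk (kernel.ι α) α (kernel.condition α)).ShortExact where
  exact := ShortComplex.exact_of_f_is_kernel _ (kernelIsKernel α)
  mono_f := inferInstanceAs (Mono (kernel.ι α))
  epi_g := inferInstanceAs (Epi α)

/-- The zero morphism is a projective morphism. -/
lemma isProjMorphism_zero [HasExt.{w} 𝒜] {X Y : 𝒜} : IsProjMorphism (0 : X ⟶ Y) := by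
  intro A δ
  simp

/-- A projective morphism factors through every epimorphism onto its target. -/
lemma IsProjMorphism.factorsThru [HasExt.{w} 𝒜] {X Y T : 𝒜} {f : T ⟶ Y}
    (hf : IsProjMorphism f) (α : X ⟶ Y) [Epi α] : FactorsThru f α := by
  obtain ⟨x, hx⟩ := Abelian.Ext.covariant_sequence_exact₃ T (shortExact_kernel α)
    (Abelian.Ext.mk₀ f) (zero_add 1) (hf _ _)
  obtain ⟨t, rfl⟩ := (Abelian.Ext.mk₀_bijective T X).2 x
  exact ⟨t, (Abelian.Ext.mk₀_bijective T Y).1 (by simpa using hx)⟩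

/-- a morphism factors through an epimorphism iff it does so modulo
projective morphisms. -/
theorem statement_1 [HasExt.{w} 𝒜] {X Y T : 𝒜} (α : X ⟶ Y) (hα : Epi α) (f : T ⟶ Y) :
    FactorsThru f α ↔ ∃ g : T ⟶ X, IsProjMorphism (f - g ≫ α) := by
  constructor
  · rintro ⟨g, rfl⟩
    exact ⟨g, by simpa using isProjMorphism_zero⟩
  · rintro ⟨g, hg⟩
    obtain ⟨t, ht⟩ := hg.factorsThru α
    exact ⟨t + g, by simp [ht]⟩
end

section
/- Let k be a field, 𝒜 a k-linear Hom-finite and Ext-finite abelian category, and let 0 → X → E → Y → 0 be an almost split short exact sequence with extension class η ∈ Ext¹(Y,X). Let γ ∈ D Ext¹(Y,X) be a k-linear functional with γ(η) ≠ 0. Then for every object M: (i) the k-linear map φ_M: Hom(M,X) → D Ext¹(Y,M) sending f to the functional μ ↦ γ(f_*μ) (where f_*μ ∈ Ext¹(Y,X) is the pushout of μ along f) is surjective, and its kernel is exactly the set of injective morphisms M → X; (ii) if μ ∈ Ext¹(Y,M) satisfies γ(f_*μ) = 0 for all f: M → X, then μ = 0; (iii) the maps φ_M are natural in M, i.e.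 φ_{M'}(f∘u)(μ') = φ_M(f)(u_*μ') for every u: M' → M and μ' ∈ Ext¹(Y,M'). -/
/- Preliminary definitions: the abelian-category instance of the extriangulated
notions of the paper (s-projective/injective morphisms and objects, almost split
short exact sequences, morphisms determined by objects, etc.). -/

open CategoryTheory CategoryTheory.Limits

attribute [local instance] CategoryTheory.Abelian.hasFiniteBiproducts

universe w v u

variable {𝒜 : Type u} [Category.{v} 𝒜] [Abelian 𝒜]

section LinearStructure

variable {k : Type*} [Field k] [CategoryTheory.Linear k 𝒜] [HasExt.{w} 𝒜]

lemma Ext_mk₀_add {X Y : 𝒜} (f g : X ⟶ Y) :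
    Abelian.Ext.mk₀ (f + g) = Abelian.Ext.mk₀ f + Abelian.Ext.mk₀ g := by
  letI := HasDerivedCategory.standard 𝒜
  ext
  simp [ShiftedHom.mk₀, Abelian.Ext.add_hom]

/-- The `k`-module structure on the `Ext`-groups of a `k`-linear abelian category,
given by the composition with `r • 𝟙 X`. -/
noncomputable instance extModule (X Y : 𝒜) (n : ℕ) : Module k (Abelian.Ext X Y n) where
  smul r e := (Abelian.Ext.mk₀ (r • 𝟙 X)).comp e (zero_add n)
  one_smul e := by
    show (Abelian.Ext.mk₀ ((1 : k) • 𝟙 X)).comp e (zero_add n) = e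
    rw [one_smul, Abelian.Ext.mk₀_id_comp]
  mul_smul r s e := by
    show (Abelian.Ext.mk₀ ((r * s) • 𝟙 X)).comp e (zero_add n) =
      (Abelian.Ext.mk₀ (r • 𝟙 X)).comp
        ((Abelian.Ext.mk₀ (s • 𝟙 X)).comp e (zero_add n)) (zero_add n)
    rw [Abelian.Ext.mk₀_comp_mk₀_assoc]
    congr 2
    rw [Linear.smul_comp, Linear.comp_smul, Category.comp_id, smul_smul]
  smul_zero r := by
    show (Abelian.Ext.mk₀ (r • 𝟙 X)).comp (0 : Abelian.Ext X Y n) (zero_add n) = 0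
    exact Abelian.Ext.comp_zero _ Y n n (zero_add n)
  smul_add r e₁ e₂ := by
    show (Abelian.Ext.mk₀ (r • 𝟙 X)).comp (e₁ + e₂) (zero_add n) = _
    rw [Abelian.Ext.comp_add]; rfl
  add_smul r s e := by
    show (Abelian.Ext.mk₀ ((r + s) • 𝟙 X)).comp e (zero_add n) = _
    rw [add_smul, Ext_mk₀_add, Abelian.Ext.add_comp]; rfl
  zero_smul e := by
    show (Abelian.Ext.mk₀ ((0 : k) • 𝟙 X)).comp e (zero_add n) = 0
    rw [zero_smul, Abelian.Ext.mk₀_zero, Abelian.Ext.zero_comp]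

end LinearStructure

open Pretriangulated DerivedCategory in
/-- Every class `μ ∈ Ext¹(Y, M)` is carried by morphisms `i : M ⟶ E` and `p : E ⟶ Y`
fitting in a distinguished triangle with connecting morphism `μ`. -/
lemma exists_distTriang_of_ext [HasExt.{w} 𝒜] [HasDerivedCategory 𝒜]
    {Y M : 𝒜} (μ : Abelian.Ext Y M 1) :
    ∃ (E : 𝒜) (i : M ⟶ E) (p : E ⟶ Y),
      Triangle.mk ((singleFunctor 𝒜 0).map i) ((singleFunctor 𝒜 0).map p) μ.hom ∈
        distTriang (DerivedCategory 𝒜) := by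
  obtain ⟨N, f, g, hT⟩ := distinguished_cocone_triangle₂
    (X := (singleFunctor 𝒜 0).obj M) (Z := (singleFunctor 𝒜 0).obj Y) μ.hom
  have hLE : N.IsLE 0 := TStructure.t.isLE₂ _ hT 0
    (inferInstanceAs (((singleFunctor 𝒜 0).obj M).IsLE 0))
    (inferInstanceAs (((singleFunctor 𝒜 0).obj Y).IsLE 0))
  have hGE : N.IsGE 0 := TStructure.t.isGE₂ _ hT 0
    (inferInstanceAs (((singleFunctor 𝒜 0).obj M).IsGE 0))
    (inferInstanceAs (((singleFunctor 𝒜 0).obj Y).IsGE 0))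
  obtain ⟨E, ⟨e⟩⟩ := exists_iso_singleFunctor_obj_of_isGE_of_isLE N 0
  obtain ⟨i, hi⟩ := (singleFunctor 𝒜 0).map_surjective (f ≫ e.hom)
  obtain ⟨p, hp⟩ := (singleFunctor 𝒜 0).map_surjective (e.inv ≫ g)
  refine ⟨E, i, p, isomorphic_distinguished _ hT _ ?_⟩
  refine Triangle.isoMk _ _ (Iso.refl _) e.symm (Iso.refl _) ?_ ?_ ?_
  · exact ((congrArg (· ≫ e.inv) hi).trans (by simp)).trans (Category.id_comp f).symm
  · exact (Category.comp_id _).trans hp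
  · exact (congrArg (μ.hom ≫ ·) ((shiftFunctor (DerivedCategory 𝒜) (1 : ℤ)).map_id _)).trans
      ((Category.comp_id μ.hom).trans (Category.id_comp μ.hom).symm)

open Pretriangulated DerivedCategory in
/-- A nonzero class `μ ∈ Ext¹(Y, M)` becomes zero along some non-retraction `p : E ⟶ Y`, and
all the classes annihilated by `p` are pushouts of `μ`. -/
lemma exists_not_isSplitEpi_of_ext_ne_zero [HasExt.{w} 𝒜]
    {Y M : 𝒜} {μ : Abelian.Ext Y M 1} (hμ : μ ≠ 0) :
    ∃ (E : 𝒜) (p : E ⟶ Y), ¬ IsSplitEpi p ∧ ∀ (X : 𝒜) (η : Abelian.Ext Y X 1),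
      (Abelian.Ext.mk₀ p).comp η (zero_add 1) = 0 →
        ∃ f : M ⟶ X, μ.comp (Abelian.Ext.mk₀ f) (add_zero 1) = η := by
  let := HasDerivedCategory.standard 𝒜
  obtain ⟨E, i, p, hT⟩ := exists_distTriang_of_ext μ
  refine ⟨E, p, fun hp ↦ hμ ?_, fun X η hη ↦ ?_⟩
  · have h : (singleFunctor 𝒜 0).map p ≫ μ.hom = 0 := comp_distTriang_mor_zero₂₃ _ hT
    ext
    rw [Abelian.Ext.zero_hom, ← cancel_epi ((singleFunctor 𝒜 0).map p), h, comp_zero]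
  · replace hη := congrArg Abelian.Ext.hom hη
    rw [Abelian.Ext.comp_hom, Abelian.Ext.mk₀_hom, ShiftedHom.mk₀_comp, Abelian.Ext.zero_hom] at hη
    obtain ⟨g, hg⟩ := Triangle.yoneda_exact₃ _ hT η.hom hη
    obtain ⟨g', rfl⟩ := (shiftFunctor (DerivedCategory 𝒜) (1 : ℤ)).map_surjective g
    obtain ⟨f, rfl⟩ := (singleFunctor 𝒜 0).map_surjective g'
    refine ⟨f, ?_⟩
    ext
    rw [Abelian.Ext.comp_hom, Abelian.Ext.mk₀_hom, ShiftedHom.comp_mk₀]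
    exact hg.symm

open Pretriangulated DerivedCategory in
/-- A nonzero class `μ ∈ Ext¹(Y, M)` becomes zero along some non-section `i : M ⟶ E`, and
all the classes annihilated by `i` are pullbacks of `μ`. -/
lemma exists_not_isSplitMono_of_ext_ne_zero [HasExt.{w} 𝒜]
    {Y M : 𝒜} {μ : Abelian.Ext Y M 1} (hμ : μ ≠ 0) :
    ∃ (E : 𝒜) (i : M ⟶ E), ¬ IsSplitMono i ∧ ∀ (A : 𝒜) (η : Abelian.Ext A M 1),
      η.comp (Abelian.Ext.mk₀ i) (add_zero 1) = 0 →
        ∃ c : A ⟶ Y, (Abelian.Ext.mk₀ c).comp μ (zero_add 1) = η := by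
  let := HasDerivedCategory.standard 𝒜
  obtain ⟨E, i, p, hT⟩ := exists_distTriang_of_ext μ
  refine ⟨E, i, fun hi ↦ hμ ?_, fun A η hη ↦ ?_⟩
  · have h : μ.hom ≫ ((singleFunctor 𝒜 0).map i)⟦(1 : ℤ)⟧' = 0 :=
      comp_distTriang_mor_zero₃₁ _ hT
    ext
    rw [Abelian.Ext.zero_hom]
    exact (cancel_mono (((singleFunctor 𝒜 0).map i)⟦(1 : ℤ)⟧')).1 (h.trans zero_comp.symm)
  · replace hη := congrArg Abelian.Ext.hom hη
    rw [Abelian.Ext.comp_hom, Abelian.Ext.mk₀_hom, ShiftedHom.comp_mk₀, Abelian.Ext.zero_hom] at hη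
    obtain ⟨g, hg⟩ := Triangle.coyoneda_exact₁ _ hT η.hom hη
    obtain ⟨c, rfl⟩ := (singleFunctor 𝒜 0).map_surjective g
    refine ⟨c, ?_⟩
    ext
    rw [Abelian.Ext.comp_hom, Abelian.Ext.mk₀_hom, ShiftedHom.mk₀_comp]
    exact hg.symm

/-- Every nonzero class in `Ext¹(Y, M)` has the class of an almost split sequence
`0 → X → E → Y → 0` as a pushout. -/
lemma IsAlmostSplitSeq.exists_pushout_eq [HasExt.{w} 𝒜] {S : ShortComplex 𝒜}
    {hS : S.ShortExact} (hAS : IsAlmostSplitSeq hS) {M : 𝒜} {μ : Abelian.Ext S.X₃ M 1}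
    (hμ : μ ≠ 0) : ∃ f : M ⟶ S.X₁, μ.comp (Abelian.Ext.mk₀ f) (add_zero 1) = hS.extClass := by
  obtain ⟨E, p, hp, h⟩ := exists_not_isSplitEpi_of_ext_ne_zero hμ
  exact h _ _ (hAS.2.2 E p hp)

/-- Every nonzero class in `Ext¹(A, X)` has the class of an almost split sequence
`0 → X → E → Y → 0` as a pullback. -/
lemma IsAlmostSplitSeq.exists_pullback_eq [HasExt.{w} 𝒜] {S : ShortComplex 𝒜}
    {hS : S.ShortExact} (hAS : IsAlmostSplitSeq hS) {A : 𝒜} {δ : Abelian.Ext A S.X₁ 1}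
    (hδ : δ ≠ 0) : ∃ c : S.X₃ ⟶ A, (Abelian.Ext.mk₀ c).comp δ (zero_add 1) = hS.extClass := by
  obtain ⟨E, i, hi, h⟩ := exists_not_isSplitMono_of_ext_ne_zero hδ
  exact h _ _ (hAS.2.1 E i hi)

section

variable {k : Type*} [Field k] [Linear k 𝒜] [HasExt.{w} 𝒜]

lemma ext_smul_eq_mk₀_comp {X Y : 𝒜} {n : ℕ} (r : k) (e : Abelian.Ext X Y n) :
    r • e = (Abelian.Ext.mk₀ (r • 𝟙 X)).comp e (zero_add n) := rfl

lemma ext_smul_comp_mk₀ {X Y Z : 𝒜} {n : ℕ} (r : k) (e : Abelian.Ext X Y n) (f : Y ⟶ Z) :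
    (r • e).comp (Abelian.Ext.mk₀ f) (add_zero n) =
      r • e.comp (Abelian.Ext.mk₀ f) (add_zero n) := by
  simp only [ext_smul_eq_mk₀_comp, Abelian.Ext.comp_assoc_of_third_deg_zero]

lemma ext_comp_mk₀_smul {X Y Z : 𝒜} {n : ℕ} (r : k) (e : Abelian.Ext X Y n) (f : Y ⟶ Z) :
    e.comp (Abelian.Ext.mk₀ (r • f)) (add_zero n) =
      r • e.comp (Abelian.Ext.mk₀ f) (add_zero n) := by
  rw [ext_smul_eq_mk₀_comp, Abelian.Ext.mk₀_smul, Abelian.Ext.mk₀_smul, Abelian.Ext.comp_smul,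
    Abelian.Ext.smul_comp, Abelian.Ext.mk₀_id_comp]

/-- The `k`-linear map `Hom(M, X) → D Ext¹(Y, M)` sending `f` to `μ ↦ γ (f_* μ)`. -/
noncomputable def homToDualExt {X Y : 𝒜} (γ : Abelian.Ext Y X 1 →ₗ[k] k) (M : 𝒜) :
    (M ⟶ X) →ₗ[k] Module.Dual k (Abelian.Ext Y M 1) :=
  LinearMap.mk₂ k (fun f μ ↦ γ (μ.comp (Abelian.Ext.mk₀ f) (add_zero 1)))
    (fun f g μ ↦ by rw [Abelian.Ext.mk₀_add, Abelian.Ext.comp_add, map_add])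
    (fun r f μ ↦ by rw [ext_comp_mk₀_smul, map_smul])
    (fun f μ ν ↦ by rw [Abelian.Ext.add_comp, map_add])
    (fun r f μ ↦ by rw [ext_smul_comp_mk₀, map_smul])

lemma homToDualExt_apply {X Y : 𝒜} (γ : Abelian.Ext Y X 1 →ₗ[k] k) {M : 𝒜} (f : M ⟶ X)
    (μ : Abelian.Ext Y M 1) :
    homToDualExt γ M f μ = γ (μ.comp (Abelian.Ext.mk₀ f) (add_zero 1)) := rfl

end

/-- A linear map to the dual of a finite-dimensional space is surjective as soon as its values
have no common nonzero zero. -/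
lemma LinearMap.surjective_of_forall_apply_eq_zero {k V W : Type*} [Field k]
    [AddCommGroup V] [Module k V] [AddCommGroup W] [Module k W] [FiniteDimensional k V]
    (φ : W →ₗ[k] Module.Dual k V) (h : ∀ v, (∀ x, φ x v = 0) → v = 0) :
    Function.Surjective φ := by
  have hφ : Function.Injective φ.flip := by
    rw [injective_iff_map_eq_zero]
    exact fun v hv ↦ h v fun x ↦ by simpa using LinearMap.congr_fun hv x
  exact LinearMap.flip_injective_iff₂.1 hφ

/-- the defect formula for an almost split sequence,
covariant version. -/
theorem statement_2 {k : Type*} [Field k] [Linear k 𝒜] [HasExt.{w} 𝒜]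
    (homFin : ∀ A B : 𝒜, FiniteDimensional k (A ⟶ B))
    (extFin : ∀ A B : 𝒜, FiniteDimensional k (Abelian.Ext A B 1))
    {S : ShortComplex 𝒜} (hS : S.ShortExact) (hAS : IsAlmostSplitSeq hS)
    (γ : Abelian.Ext S.X₃ S.X₁ 1 →ₗ[k] k) (hγ : γ hS.extClass ≠ 0) (M : 𝒜) :
    (∀ χ : Abelian.Ext S.X₃ M 1 →ₗ[k] k, ∃ f : M ⟶ S.X₁,
        ∀ μ : Abelian.Ext S.X₃ M 1, γ (μ.comp (Abelian.Ext.mk₀ f) (add_zero 1)) = χ μ) ∧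
    (∀ f : M ⟶ S.X₁,
        (∀ μ : Abelian.Ext S.X₃ M 1, γ (μ.comp (Abelian.Ext.mk₀ f) (add_zero 1)) = 0)
          ↔ IsInjMorphism f) ∧
    (∀ μ : Abelian.Ext S.X₃ M 1,
        (∀ f : M ⟶ S.X₁, γ (μ.comp (Abelian.Ext.mk₀ f) (add_zero 1)) = 0) → μ = 0) ∧
    (∀ (M' : 𝒜) (u : M' ⟶ M) (f : M ⟶ S.X₁) (μ' : Abelian.Ext S.X₃ M' 1),
        γ (μ'.comp (Abelian.Ext.mk₀ (u ≫ f)) (add_zero 1)) =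
          γ ((μ'.comp (Abelian.Ext.mk₀ u) (add_zero 1)).comp
              (Abelian.Ext.mk₀ f) (add_zero 1))) := by
  have nondeg : ∀ μ : Abelian.Ext S.X₃ M 1,
      (∀ f : M ⟶ S.X₁, γ (μ.comp (Abelian.Ext.mk₀ f) (add_zero 1)) = 0) → μ = 0 := by
    intro μ h
    by_contra hμ
    obtain ⟨f, hf⟩ := hAS.exists_pushout_eq hμ
    exact hγ (hf ▸ h f)
  refine ⟨fun χ ↦ ?_, fun f ↦ ⟨fun h A δ ↦ ?_, fun h μ ↦ by rw [h, map_zero]⟩, nondeg,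
    fun M' u f μ' ↦ ?_⟩
  · have := extFin S.X₃ M
    obtain ⟨f, hf⟩ := (homToDualExt γ M).surjective_of_forall_apply_eq_zero nondeg χ
    exact ⟨f, fun μ ↦ by rw [← hf, homToDualExt_apply]⟩
  · by_contra hδ
    obtain ⟨c, hc⟩ := hAS.exists_pullback_eq hδ
    rw [← Abelian.Ext.comp_assoc_of_third_deg_zero] at hc
    exact hγ (hc ▸ h _)
  · rw [Abelian.Ext.comp_assoc_of_third_deg_zero, Abelian.Ext.mk₀_comp_mk₀]
end

section
/- Let k be a field, 𝒜 a k-linear Hom-finite, Ext-finite and Krull–Schmidt abelian category, and Y an indecomposable object. Suppose there exists an object Y' having an indecomposable non-injective direct summand, together with, for every object M, a surjective k-linear map φ_M: Hom(M,Y') → D Ext¹(Y,M) whose kernel is exactly the set of injective morphisms M → Y', such that the φ_M are natural in M (φ_{M'}(f∘u) = φ_M(f)∘(u_*) for every u: M' → M and f: M → Y'). Then there exists an almost split short exact sequence 0 → X → E → Y → 0 ending at Y. -/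
/- Preliminary definitions: the abelian-category instance of the extriangulated
notions of the paper (s-projective/injective morphisms and objects, almost split
short exact sequences, morphisms determined by objects, etc.). -/

open CategoryTheory CategoryTheory.Limits

attribute [local instance] CategoryTheory.Abelian.hasFiniteBiproducts

universe w v u

variable {𝒜 : Type u} [Category.{v} 𝒜] [Abelian 𝒜]

section ExtensionClasses

open Pretriangulated DerivedCategory Abelian

theorem DerivedCategory.shortExact_of_singleFunctor_distinguished
    [HasDerivedCategory.{w} 𝒜] {S : ShortComplex 𝒜}
    {h : (singleFunctor 𝒜 0).obj S.X₃ ⟶ ((singleFunctor 𝒜 0).obj S.X₁)⟦(1 : ℤ)⟧}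
    (hT : Triangle.mk ((singleFunctor 𝒜 0).map S.f) ((singleFunctor 𝒜 0).map S.g) h ∈
      distTriang (DerivedCategory 𝒜)) : S.ShortExact := by
  let α := singleFunctorCompHomologyFunctorIso 𝒜 0
  have : (singleFunctor 𝒜 0 ⋙ homologyFunctor 𝒜 0).Faithful := Functor.Faithful.of_iso α.symm
  have hf : Mono ((singleFunctor 𝒜 0 ⋙ homologyFunctor 𝒜 0).map S.f) :=
    (HomologySequence.mono_homologyMap_mor₁_iff _ hT (-1) 0).2
      ((isZero_of_isGE ((singleFunctor 𝒜 0).obj S.X₃) 0 (-1) (by lia)).eq_of_src _ _)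
  have hg : Epi ((singleFunctor 𝒜 0 ⋙ homologyFunctor 𝒜 0).map S.g) :=
    (HomologySequence.epi_homologyMap_mor₂_iff _ hT 0 1).2
      ((isZero_of_isLE ((singleFunctor 𝒜 0).obj S.X₁) 0 1 (by lia)).eq_of_tgt _ _)
  exact
    { exact := ShortComplex.exact_of_iso
        (ShortComplex.isoMk (α.app _) (α.app _) (α.app _)
          (α.hom.naturality S.f).symm (α.hom.naturality S.g).symm)
        (HomologySequence.exact₂ _ hT 0)
      mono_f := Functor.mono_of_mono_map _ hf
      epi_g := Functor.epi_of_epi_map _ hg }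

theorem CategoryTheory.ShortComplex.ShortExact.singleδ_eq_of_distinguished
    [HasDerivedCategory.{w} 𝒜] {S : ShortComplex 𝒜} (hS : S.ShortExact)
    {h : (singleFunctor 𝒜 0).obj S.X₃ ⟶ ((singleFunctor 𝒜 0).obj S.X₁)⟦(1 : ℤ)⟧}
    (hT : Triangle.mk ((singleFunctor 𝒜 0).map S.f) ((singleFunctor 𝒜 0).map S.g) h ∈
      distTriang (DerivedCategory 𝒜)) : hS.singleδ = h := by
  obtain ⟨c, hc₁, hc₂⟩ := complete_distinguished_triangle_morphism _ _
    hS.singleTriangle_distinguished hT (𝟙 _) (𝟙 _)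
    ((Category.comp_id _).trans (Category.id_comp _).symm)
  obtain ⟨c, rfl⟩ := (singleFunctor 𝒜 0).map_surjective c
  have := hS.epi_g
  have hc : c = 𝟙 _ := by
    rw [← cancel_epi S.g]
    apply (singleFunctor 𝒜 0).map_injective
    rw [Functor.map_comp, Category.comp_id]
    exact hc₁.trans (Category.id_comp _)
  subst hc
  exact (Category.comp_id _).symm.trans
    ((hS.singleδ ≫= (shiftFunctor _ (1 : ℤ)).map_id _).symm.trans <| hc₂.trans <|
      ((singleFunctor 𝒜 0).map_id _ =≫ h).trans (Category.id_comp _))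

theorem CategoryTheory.Abelian.Ext.exists_eq_extClass [HasExt.{w} 𝒜] {X Y : 𝒜} (η : Ext Y X 1) :
    ∃ (E : 𝒜) (i : X ⟶ E) (p : E ⟶ Y) (hip : i ≫ p = 0)
      (hS : (ShortComplex.mk i p hip).ShortExact), hS.extClass = η := by
  let := HasDerivedCategory.standard 𝒜
  obtain ⟨E, f, g, hT⟩ := distinguished_cocone_triangle₂ η.hom
  have : E.IsGE 0 := TStructure.t.isGE₂ _ hT 0
    (inferInstanceAs (((singleFunctor 𝒜 0).obj X).IsGE 0))
    (inferInstanceAs (((singleFunctor 𝒜 0).obj Y).IsGE 0))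
  have : E.IsLE 0 := TStructure.t.isLE₂ _ hT 0
    (inferInstanceAs (((singleFunctor 𝒜 0).obj X).IsLE 0))
    (inferInstanceAs (((singleFunctor 𝒜 0).obj Y).IsLE 0))
  obtain ⟨E', ⟨e⟩⟩ := exists_iso_singleFunctor_obj_of_isGE_of_isLE E 0
  obtain ⟨i, hi⟩ := (singleFunctor 𝒜 0).map_surjective (f ≫ e.hom)
  obtain ⟨p, hp⟩ := (singleFunctor 𝒜 0).map_surjective (e.inv ≫ g)
  have hT' : Triangle.mk ((singleFunctor 𝒜 0).map i) ((singleFunctor 𝒜 0).map p) η.hom ∈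
      distTriang (DerivedCategory 𝒜) :=
    isomorphic_distinguished _ hT _
      (Triangle.isoMk _ _ (Iso.refl _) e.symm (Iso.refl _)
        (((Iso.eq_comp_inv e).2 hi.symm).symm.trans (Category.id_comp _).symm)
        ((Category.comp_id _).trans hp)
        (((η.hom ≫= (shiftFunctor _ (1 : ℤ)).map_id _).trans (Category.comp_id _)).trans
          (Category.id_comp _).symm))
  have hip : i ≫ p = 0 := (singleFunctor 𝒜 0).map_injective <| by
    rw [Functor.map_comp, Functor.map_zero]
    exact comp_distTriang_mor_zero₁₂ _ hT'
  have hS : (ShortComplex.mk i p hip).ShortExact :=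
    shortExact_of_singleFunctor_distinguished hT'
  refine ⟨E', i, p, hip, hS, ?_⟩
  ext
  rw [ShortComplex.ShortExact.extClass_hom]
  exact hS.singleδ_eq_of_distinguished hT'

end ExtensionClasses

theorem Indec.isIso_of_isSplitMono {X Z : 𝒜} (hX : Indec X) (hZ : ¬ IsZero Z) (i : Z ⟶ X)
    [IsSplitMono i] : IsIso i := by
  let S := ShortComplex.mk i (cokernel.π i) (cokernel.condition i)
  have s : S.Splitting := .ofExactOfRetraction S
    (S.exact_of_g_is_cokernel (cokernelIsCokernel i)) (retraction i) (IsSplitMono.id i)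
    (inferInstanceAs (Epi (cokernel.π i)))
  rcases hX.2 _ _ ⟨s.isoBinaryBiproduct⟩ with h | h
  · exact absurd h hZ
  · have : Epi i := Preadditive.epi_of_isZero_cokernel i h
    exact isIso_of_epi_of_isSplitMono i

theorem IsLocalRing.of_ringEquiv {R R' : Type*} [Semiring R] [Semiring R'] [IsLocalRing R]
    (e : R ≃+* R') : IsLocalRing R' where
  toNontrivial := e.injective.nontrivial
  isUnit_or_isUnit_of_add_one {a b} h :=
    (IsLocalRing.isUnit_or_isUnit_of_add_one (by rw [← map_add e.symm, h, map_one])).imp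
      (MulEquiv.isUnit_map e.symm).1 (MulEquiv.isUnit_map e.symm).1

theorem Indec.isLocalRing_end (hKS : IsKrullSchmidtCat 𝒜) {X : 𝒜} (hX : Indec X) :
    IsLocalRing (End X) := by
  obtain ⟨n, Z, ⟨e⟩, hZ⟩ := hKS X
  cases n with
  | zero =>
    refine absurd (IsZero.of_iso ?_ e) hX.1
    rw [IsZero.iff_id_eq_zero]
    ext j
    exact j.elim0
  | succ n =>
    have := hZ 0
    have hZ₀ : ¬ IsZero (Z 0) := fun h ↦ one_ne_zero (α := End (Z 0)) (h.eq_of_src _ _)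
    have : IsIso (biproduct.ι Z 0 ≫ e.inv) := hX.isIso_of_isSplitMono hZ₀ _
    let c : End (Z 0) ≃* End X := (asIso (biproduct.ι Z 0 ≫ e.inv)).conj
    let c' : End (Z 0) ≃+* End X :=
      { c with
        map_add' := fun a b ↦ by
          change inv _ ≫ ((a : Z 0 ⟶ Z 0) + b) ≫ _ = inv _ ≫ (a : Z 0 ⟶ Z 0) ≫ _ + inv _ ≫ b ≫ _
          rw [Preadditive.add_comp, Preadditive.comp_add] }
    exact .of_ringEquiv c'

theorem isSplitMono_or_isSplitMono_of_add {Z X : 𝒜} [IsLocalRing (End Z)] {f g : Z ⟶ X}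
    (h : IsSplitMono (f + g)) : IsSplitMono f ∨ IsSplitMono g := by
  have hu : ∀ u : Z ⟶ X, IsUnit (M := End Z) (u ≫ retraction (f + g)) → IsSplitMono u := by
    intro u hu
    have : IsIso (u ≫ retraction (f + g)) := (isUnit_iff_isIso _).1 hu
    exact IsSplitMono.mk' ⟨retraction (f + g) ≫ inv (u ≫ retraction (f + g)), by
      rw [← Category.assoc, IsIso.hom_inv_id]⟩
  refine (IsLocalRing.isUnit_or_isUnit_of_add_one (R := End Z)
    (a := f ≫ retraction (f + g)) (b := g ≫ retraction (f + g)) ?_).imp (hu f) (hu g)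
  exact (Preadditive.add_comp ..).symm.trans (IsSplitMono.id (f + g))

theorem isSplitMono_of_smul {k : Type*} [Field k] [Linear k 𝒜] {Z X : 𝒜} {c : k} {f : Z ⟶ X}
    (h : IsSplitMono (c • f)) : IsSplitMono f :=
  IsSplitMono.mk' ⟨c • retraction (c • f), by
    rw [Linear.comp_smul, ← Linear.smul_comp, IsSplitMono.id]⟩

/-- The morphisms out of a nonzero object with local endomorphism ring which are not split
monomorphisms form a subspace. -/
def nonSplitMonoSubmodule (k : Type*) [Field k] [Linear k 𝒜] (Z X : 𝒜) [IsLocalRing (End Z)] :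
    Submodule k (Z ⟶ X) where
  carrier := {f | ¬ IsSplitMono f}
  add_mem' hf hg h := (isSplitMono_or_isSplitMono_of_add h).elim hf hg
  zero_mem' h := one_ne_zero (α := End Z) <| by
    change 𝟙 Z = 0
    rw [← IsSplitMono.id (0 : Z ⟶ X), zero_comp]
  smul_mem' _ _ hf h := hf (isSplitMono_of_smul h)

theorem IsAlmostSplitSeq.of_isLocalRing_end [HasExt.{w} 𝒜] {S : ShortComplex 𝒜}
    (hS : S.ShortExact) [IsLocalRing (End S.X₃)] (h₀ : hS.extClass ≠ 0)
    (h₁ : ∀ (X' : 𝒜) (a : S.X₁ ⟶ X'), ¬ IsSplitMono a →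
      hS.extClass.comp (Abelian.Ext.mk₀ a) (add_zero 1) = 0) : IsAlmostSplitSeq hS := by
  refine ⟨h₀, h₁, fun W c hc ↦ ?_⟩
  by_contra hne
  obtain ⟨E, i, p, hip, hE, hη⟩ :=
    Abelian.Ext.exists_eq_extClass ((Abelian.Ext.mk₀ c).comp hS.extClass (zero_add 1))
  have hi : ¬ IsSplitMono i := by
    intro hi
    apply hne
    rw [← hη, ← hE.extClass.comp_mk₀_id, ← IsSplitMono.id i, ← Abelian.Ext.mk₀_comp_mk₀]
    exact hE.extClass_comp_assoc _
  obtain ⟨s, hs⟩ := Abelian.Ext.covariant_sequence_exact₁ S.X₃ hE _ (h₁ _ i hi)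
    (zero_add 1)
  obtain ⟨s, rfl⟩ := (Abelian.Ext.mk₀_bijective _ _).2 s
  rw [hη, Abelian.Ext.mk₀_comp_mk₀_assoc] at hs
  change S.X₃ ⟶ W at s
  rcases IsLocalRing.isUnit_or_isUnit_of_add_one (R := End S.X₃)
    (a := s ≫ c) (b := 𝟙 _ - s ≫ c) (add_sub_cancel _ _) with hu | hu
  · have := (isUnit_iff_isIso _).1 hu
    exact hc (IsSplitEpi.mk' ⟨inv (s ≫ c) ≫ s, by rw [Category.assoc, IsIso.inv_hom_id]⟩)
  · have := (isUnit_iff_isIso _).1 hu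
    apply h₀
    have h : (Abelian.Ext.mk₀ (𝟙 S.X₃ - s ≫ c)).comp hS.extClass (zero_add 1) = 0 := by
      have h := congrArg (fun f ↦ (Abelian.Ext.mk₀ f).comp hS.extClass (zero_add 1))
        (sub_add_cancel (𝟙 S.X₃) (s ≫ c))
      simpa only [Ext_mk₀_add, Abelian.Ext.add_comp, hs, Abelian.Ext.mk₀_id_comp,
        add_eq_right] using h
    rw [← hS.extClass.mk₀_id_comp, ← IsIso.inv_hom_id (𝟙 S.X₃ - s ≫ c),
      ← Abelian.Ext.mk₀_comp_mk₀_assoc, h, Abelian.Ext.comp_zero]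

theorem exists_ne_zero_forall_mem_dual_apply_eq_zero {k V : Type*} [Field k] [AddCommGroup V]
    [Module k V] [FiniteDimensional k V] {W : Submodule k (Module.Dual k V)} (hW : W ≠ ⊤) :
    ∃ v : V, v ≠ 0 ∧ ∀ w ∈ W, w v = 0 := by
  have h : W.dualCoannihilator ≠ ⊥ := fun h ↦ hW <| by
    rw [← Subspace.dualCoannihilator_dualAnnihilator_eq (W := W), h,
      Submodule.dualAnnihilator_bot]
  obtain ⟨v, hv, hv₀⟩ := Submodule.exists_mem_ne_zero_of_ne_bot h
  exact ⟨v, hv₀, (Submodule.mem_dualCoannihilator v).1 hv⟩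

theorem IsInjMorphism.isExtInjective [HasExt.{w} 𝒜] {Z X : 𝒜} {f : Z ⟶ X}
    (hf : IsInjMorphism f) [IsSplitMono f] : IsExtInjective Z := by
  intro A δ
  rw [← δ.comp_mk₀_id, ← IsSplitMono.id f, ← Abelian.Ext.mk₀_comp_mk₀,
    ← Abelian.Ext.comp_assoc_of_second_deg_zero, hf, Abelian.Ext.zero_comp]

/-- representability of `D Ext¹(Y, −)` on the costable category forces
the existence of an almost split sequence ending at `Y`. -/
theorem statement_4 {k : Type*} [Field k] [Linear k 𝒜] [HasExt.{w} 𝒜]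
    (homFin : ∀ A B : 𝒜, FiniteDimensional k (A ⟶ B))
    (extFin : ∀ A B : 𝒜, FiniteDimensional k (Abelian.Ext A B 1))
    (hKS : IsKrullSchmidtCat 𝒜)
    {Y Y' : 𝒜} (hY : Indec Y)
    (hY' : ∃ Z : 𝒜, IsDirectSummand Z Y' ∧ Indec Z ∧ ¬ IsExtInjective Z)
    (φ : ∀ M : 𝒜, (M ⟶ Y') →ₗ[k] (Abelian.Ext Y M 1 →ₗ[k] k))
    (hsurj : ∀ M : 𝒜, Function.Surjective (φ M))
    (hker : ∀ (M : 𝒜) (f : M ⟶ Y'), φ M f = 0 ↔ IsInjMorphism f)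
    (hnat : ∀ (M M' : 𝒜) (u : M' ⟶ M) (f : M ⟶ Y') (μ' : Abelian.Ext Y M' 1),
      φ M' (u ≫ f) μ' = φ M f (μ'.comp (Abelian.Ext.mk₀ u) (add_zero 1))) :
    ExistsAlmostSplitEndingAt Y := by
  obtain ⟨Z, ⟨i, r, hir⟩, hZ, hZinj⟩ := hY'
  have := hZ.isLocalRing_end hKS
  have := hY.isLocalRing_end hKS
  have := extFin Y Z
  have hi : IsSplitMono i := IsSplitMono.mk' ⟨r, hir⟩
  have hR : (nonSplitMonoSubmodule k Z Y').map (φ Z) ≠ ⊤ := by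
    intro htop
    obtain ⟨g, hg, hgi⟩ := (Submodule.eq_top_iff'.1 htop) (φ Z i)
    have hinj : IsInjMorphism (i - g) := by rw [← hker, map_sub, hgi, sub_self]
    rcases isSplitMono_or_isSplitMono_of_add (f := i - g) (g := g)
      (by rwa [sub_add_cancel]) with h | h
    · exact hZinj hinj.isExtInjective
    · exact hg h
  obtain ⟨η, hη₀, hη⟩ := exists_ne_zero_forall_mem_dual_apply_eq_zero hR
  obtain ⟨E, j, p, w, hS, rfl⟩ := Abelian.Ext.exists_eq_extClass η
  refine ⟨Z, E, j, p, w, hS, .of_isLocalRing_end hS hη₀ fun X' a ha ↦ ?_⟩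
  rw [← Module.forall_dual_apply_eq_zero_iff k]
  intro ψ
  obtain ⟨f, rfl⟩ := hsurj X' ψ
  rw [← hnat]
  refine hη _ (Submodule.mem_map_of_mem fun h ↦ ha ?_)
  exact IsSplitMono.mk' ⟨f ≫ retraction (a ≫ f), by rw [← Category.assoc, IsSplitMono.id]⟩
end

section
/- Let k be a field, 𝒜 a k-linear Hom-finite, Ext-finite and Krull–Schmidt abelian category, and Y an indecomposable non-injective object. Then the following are equivalent: (1) there exist an object Z and, for every object M, a surjective k-linear map ψ_M: Hom(Z,M) → D Ext¹(M,Y), natural in M, whose kernel is exactly the set of projective morphisms Z → M (i.e. the functor D Ext¹(−,Y) is representable on the stable category, so Y lies in 𝒜_l); (2) there exists an almost split short exact sequence 0 → Y → E → Z' → 0 starting at Y. -/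
/- Preliminary definitions: the abelian-category instance of the extriangulated
notions of the paper (s-projective/injective morphisms and objects, almost split
short exact sequences, morphisms determined by objects, etc.). -/

open CategoryTheory CategoryTheory.Limits

attribute [local instance] CategoryTheory.Abelian.hasFiniteBiproducts

universe w v u

variable {𝒜 : Type u} [Category.{v} 𝒜] [Abelian 𝒜]

open Pretriangulated DerivedCategory Triangulated in
/-- Every class in `Ext¹` is the class of a short exact sequence. -/
lemma exists_shortExact_extClass_eq {C : Type u} [Category.{v} C] [Abelian C] [HasExt.{w} C]
    {X Y : C} (e : Abelian.Ext X Y 1) :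
    ∃ (E : C) (i : Y ⟶ E) (p : E ⟶ X) (w : i ≫ p = 0)
      (hS : (ShortComplex.mk i p w).ShortExact), hS.extClass = e := by
  let := HasDerivedCategory.standard C
  let F := singleFunctor C 0
  have hLE (A : C) : TStructure.t.IsLE (F.obj A) 0 :=
    inferInstanceAs (((singleFunctor C 0).obj A).IsLE 0)
  have hGE (A : C) : TStructure.t.IsGE (F.obj A) 0 :=
    inferInstanceAs (((singleFunctor C 0).obj A).IsGE 0)
  obtain ⟨E', i', p', hT'⟩ := distinguished_cocone_triangle₂ (Z := F.obj X) (X := F.obj Y) e.hom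
  have : E'.IsLE 0 := TStructure.t.isLE₂ _ hT' 0 (hLE Y) (hLE X)
  have : E'.IsGE 0 := TStructure.t.isGE₂ _ hT' 0 (hGE Y) (hGE X)
  obtain ⟨E, ⟨α⟩⟩ := exists_iso_singleFunctor_obj_of_isGE_of_isLE E' 0
  let i : Y ⟶ E := F.preimage (i' ≫ α.hom)
  let p : E ⟶ X := F.preimage (α.inv ≫ p')
  have hi : F.map i = i' ≫ α.hom := F.map_preimage _
  have hp : F.map p = α.inv ≫ p' := F.map_preimage _
  have hT : Triangle.mk (F.map i) (F.map p) e.hom ∈ distTriang (DerivedCategory C) := by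
    rw [hi, hp]
    refine isomorphic_distinguished _ hT' _
      (Triangle.isoMk _ _ (Iso.refl (F.obj Y)) α.symm (Iso.refl (F.obj X)) ?_ ?_ ?_)
    · change (i' ≫ α.hom) ≫ α.inv = 𝟙 (F.obj Y) ≫ i'
      simp
    · change (α.inv ≫ p') ≫ 𝟙 (F.obj X) = α.inv ≫ p'
      simp
    · change e.hom ≫ (𝟙 (F.obj Y))⟦(1 : ℤ)⟧' = 𝟙 (F.obj X) ≫ e.hom
      rw [CategoryTheory.Functor.map_id, Category.id_comp]
      exact Category.comp_id _
  have hF : ∀ ⦃A B : C⦄ ⦃n : ℤ⦄ (f : F.obj A ⟶ (F.obj B)⟦n⟧), n < 0 → f = 0 := by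
    intro A B n f hn
    have := TStructure.t.isGE_shift (F.obj B) 0 n (-n)
    exact TStructure.t.zero f 0 (-n)
  have w : i ≫ p = 0 := by
    apply F.map_injective
    rw [F.map_comp, F.map_zero]
    exact comp_distTriang_mor_zero₁₂ _ hT
  have hker := AbelianSubcategory.isLimitKernelForkOfDistTriang hF i p e.hom hT
  have hcoker := AbelianSubcategory.isColimitCokernelCoforkOfDistTriang hF i p e.hom hT
  have : Mono i := Fork.IsLimit.mono hker
  have : Epi p := Cofork.IsColimit.epi hcoker
  have hS : (ShortComplex.mk i p w).ShortExact :=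
    { exact := ShortComplex.exact_of_f_is_kernel _ hker }
  refine ⟨E, i, p, w, hS, ?_⟩
  obtain ⟨c, hc₁, hc₂⟩ := complete_distinguished_triangle_morphism _ _
    hS.singleTriangle_distinguished hT (𝟙 (F.obj Y)) (𝟙 (F.obj E))
    ((Category.comp_id (F.map i)).trans (Category.id_comp (F.map i)).symm)
  obtain ⟨c, rfl⟩ := F.map_surjective c
  have hc : c = 𝟙 X := by
    rw [← cancel_epi p, Category.comp_id]
    apply F.map_injective
    rw [F.map_comp]
    exact hc₁.trans (Category.id_comp (F.map p))
  subst hc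
  apply Abelian.Ext.ext
  rw [ShortComplex.ShortExact.extClass_hom]
  change hS.singleδ ≫ (𝟙 (F.obj Y))⟦(1 : ℤ)⟧' = F.map (𝟙 X) ≫ e.hom at hc₂
  rw [CategoryTheory.Functor.map_id, CategoryTheory.Functor.map_id] at hc₂
  exact (Category.comp_id hS.singleδ).symm.trans (hc₂.trans (Category.id_comp e.hom))

section AlmostSplitClasses

variable [HasExt.{w} 𝒜]

/-- A class killed by pullback along all non-retractions is a pushout of every nonzero class
with the same first argument. -/
lemma exists_comp_mk₀_eq {Z A Y : 𝒜} {ε : Abelian.Ext Z A 1} (hε : ε ≠ 0)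
    {η : Abelian.Ext Z Y 1}
    (hη : ∀ (Z' : 𝒜) (c : Z' ⟶ Z), ¬ IsSplitEpi c →
      (Abelian.Ext.mk₀ c).comp η (zero_add 1) = 0) :
    ∃ b : A ⟶ Y, ε.comp (Abelian.Ext.mk₀ b) (add_zero 1) = η := by
  obtain ⟨E, i, p, w, hS, rfl⟩ := exists_shortExact_extClass_eq ε
  have hp : ¬ IsSplitEpi p := fun ⟨⟨s⟩⟩ ↦ hε <| by
    have h : (Abelian.Ext.mk₀ p).comp hS.extClass (zero_add 1) = 0 := hS.comp_extClass
    rw [← Abelian.Ext.mk₀_id_comp hS.extClass]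
    change (Abelian.Ext.mk₀ (𝟙 Z)).comp _ _ = 0
    rw [← s.id, ← Abelian.Ext.mk₀_comp_mk₀_assoc, h, Abelian.Ext.comp_zero]
  obtain ⟨x, hx⟩ :=
    Abelian.Ext.contravariant_sequence_exact₃ hS Y η (hη _ p hp) (add_zero 1)
  obtain ⟨b, rfl⟩ := (Abelian.Ext.mk₀_bijective _ _).2 x
  exact ⟨b, hx⟩

/-- A class killed by pushout along all non-sections is a pullback of every nonzero class
with the same second argument. -/
lemma exists_mk₀_comp_eq {Z M Y : 𝒜} {μ : Abelian.Ext M Y 1} (hμ : μ ≠ 0)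
    {η : Abelian.Ext Z Y 1}
    (hη : ∀ (Y' : 𝒜) (a : Y ⟶ Y'), ¬ IsSplitMono a →
      η.comp (Abelian.Ext.mk₀ a) (add_zero 1) = 0) :
    ∃ g : Z ⟶ M, (Abelian.Ext.mk₀ g).comp μ (zero_add 1) = η := by
  obtain ⟨E, i, p, w, hS, rfl⟩ := exists_shortExact_extClass_eq μ
  have hi : ¬ IsSplitMono i := fun ⟨⟨r⟩⟩ ↦ hμ <| by
    have h : hS.extClass.comp (Abelian.Ext.mk₀ i) (add_zero 1) = 0 := hS.extClass_comp
    rw [← Abelian.Ext.comp_mk₀_id hS.extClass]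
    change Abelian.Ext.comp _ (Abelian.Ext.mk₀ (𝟙 Y)) _ = 0
    rw [← r.id, ← Abelian.Ext.mk₀_comp_mk₀,
      ← Abelian.Ext.comp_assoc_of_third_deg_zero, h, Abelian.Ext.zero_comp]
  obtain ⟨x, hx⟩ :=
    Abelian.Ext.covariant_sequence_exact₁ Z hS η (hη _ i hi) (zero_add 1)
  obtain ⟨g, rfl⟩ := (Abelian.Ext.mk₀_bijective _ _).2 x
  exact ⟨g, hx⟩

/-- An object which is the target of a projective retraction is projective. -/
lemma IsProjMorphism.isExtProjective {Z Z' : 𝒜} {g : Z ⟶ Z'} (hg : IsProjMorphism g)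
    [IsSplitEpi g] : IsExtProjective Z' := fun A δ ↦ by
  rw [← Abelian.Ext.mk₀_id_comp δ, ← IsSplitEpi.id g, ← Abelian.Ext.mk₀_comp_mk₀_assoc,
    hg A δ, Abelian.Ext.comp_zero]

/-- A finite biproduct of projective objects is projective. -/
lemma isExtProjective_of_iso_biproduct {n : ℕ} {Z : 𝒜} {W : Fin n → 𝒜} (e : Z ≅ ⨁ W)
    (hW : ∀ i, IsExtProjective (W i)) : IsExtProjective Z := fun A δ ↦ by
  have h : 𝟙 Z = ∑ i, (e.hom ≫ biproduct.π W i) ≫ biproduct.ι W i ≫ e.inv := by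
    conv_lhs => rw [← e.hom_inv_id, ← Category.id_comp e.inv, ← biproduct.total]
    simp only [Preadditive.sum_comp, Preadditive.comp_sum, Category.assoc]
  rw [← Abelian.Ext.mk₀_id_comp δ, h, Abelian.Ext.mk₀_sum, Abelian.Ext.sum_comp]
  refine Finset.sum_eq_zero fun i _ ↦ ?_
  rw [← Abelian.Ext.mk₀_comp_mk₀_assoc, hW i A (Abelian.Ext.comp _ δ _),
    Abelian.Ext.comp_zero]

/-- If `Y` has local endomorphism ring, a nonzero class in `Ext¹(Z, Y)` killed by pullback along
all non-retractions is killed by pushout along all non-sections. -/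
lemma comp_mk₀_eq_zero_of_not_isSplitMono {Z Y : 𝒜}
    (hY : ∀ e : Y ⟶ Y, IsIso e ∨ IsIso (𝟙 Y - e)) {η : Abelian.Ext Z Y 1} (hη₀ : η ≠ 0)
    (hη : ∀ (Z' : 𝒜) (c : Z' ⟶ Z), ¬ IsSplitEpi c →
      (Abelian.Ext.mk₀ c).comp η (zero_add 1) = 0)
    (X : 𝒜) (a : Y ⟶ X) (ha : ¬ IsSplitMono a) :
    η.comp (Abelian.Ext.mk₀ a) (add_zero 1) = 0 := by
  by_contra h
  obtain ⟨b, hb⟩ := exists_comp_mk₀_eq h hη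
  rw [Abelian.Ext.comp_assoc_of_third_deg_zero, Abelian.Ext.mk₀_comp_mk₀] at hb
  rcases hY (a ≫ b) with h₁ | h₁
  · exact ha ⟨⟨⟨b ≫ inv (a ≫ b), by rw [← Category.assoc, IsIso.hom_inv_id]⟩⟩⟩
  · have h₂ : η.comp (Abelian.Ext.mk₀ (𝟙 Y - a ≫ b)) (add_zero 1) = 0 := by
      rw [sub_eq_add_neg, Abelian.Ext.mk₀_add, Abelian.Ext.mk₀_neg, Abelian.Ext.comp_add,
        Abelian.Ext.comp_neg, hb, Abelian.Ext.comp_mk₀_id, add_neg_cancel]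
    apply hη₀
    rw [← Abelian.Ext.comp_mk₀_id η, ← IsIso.hom_inv_id (𝟙 Y - a ≫ b),
      ← Abelian.Ext.mk₀_comp_mk₀, ← Abelian.Ext.comp_assoc_of_third_deg_zero, h₂,
      Abelian.Ext.zero_comp]

end AlmostSplitClasses

lemma isIso_or_isIso_one_sub_of_isLocalRing {X : 𝒜} [IsLocalRing (End X)] (e : X ⟶ X) :
    IsIso e ∨ IsIso (𝟙 X - e) :=
  (IsLocalRing.isUnit_or_isUnit_of_add_one (R := End X) (a := e) (b := (𝟙 X - e : X ⟶ X))
    (add_sub_cancel (G := X ⟶ X) e (𝟙 X))).imp (isUnit_iff_isIso e).1 (isUnit_iff_isIso _).1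

/-- A nonzero retract of an indecomposable object is isomorphic to it. -/
lemma Indec.isIso_of_isSplitEpi {X A : 𝒜} (hX : Indec X) (hA : ¬ IsZero A) (r : X ⟶ A)
    [IsSplitEpi r] : IsIso r := by
  have hex := ShortComplex.exact_of_f_is_kernel
    (ShortComplex.mk (kernel.ι r) r (kernel.condition r)) (kernelIsKernel r)
  have s := ShortComplex.Splitting.ofExactOfSection _ hex (section_ r) (by simp)
    (inferInstanceAs (Mono (kernel.ι r)))
  have hker := (hX.2 _ _ ⟨s.isoBinaryBiproduct⟩).resolve_right hA
  have : Mono r := Preadditive.mono_of_kernel_zero (hker.eq_of_src _ _)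
  exact isIso_of_mono_of_epi r

/-- Indecomposable objects of Krull–Schmidt categories satisfy the local endomorphism
dichotomy. -/
lemma Indec.isIso_or_isIso_one_sub (hKS : IsKrullSchmidtCat 𝒜) {Y : 𝒜} (hY : Indec Y)
    (e : Y ⟶ Y) : IsIso e ∨ IsIso (𝟙 Y - e) := by
  obtain ⟨n, W, ⟨α⟩, hW⟩ := hKS Y
  cases n with
  | zero =>
    refine absurd (IsZero.of_iso ?_ α) hY.1
    rw [IsZero.iff_id_eq_zero]
    ext i
    exact i.elim0
  | succ n =>
    have := hW 0
    have hW₀ : ¬ IsZero (W 0) := fun h ↦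
      one_ne_zero (α := End (W 0)) (h.eq_of_src _ _)
    let r : Y ⟶ W 0 := α.hom ≫ biproduct.π W 0
    have : IsSplitEpi r := ⟨⟨⟨biproduct.ι W 0 ≫ α.inv, by simp [r]⟩⟩⟩
    have := hY.isIso_of_isSplitEpi hW₀ r
    have h₁ (f : Y ⟶ Y) [IsIso (inv r ≫ f ≫ r)] : IsIso f := by
      have : f = r ≫ (inv r ≫ f ≫ r) ≫ inv r := by simp
      rw [this]
      infer_instance
    rcases isIso_or_isIso_one_sub_of_isLocalRing (inv r ≫ e ≫ r) with h | h
    · exact Or.inl (h₁ e)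
    · have : IsIso (inv r ≫ (𝟙 Y - e) ≫ r) := by
        simpa [Preadditive.sub_comp, Preadditive.comp_sub] using h
      exact Or.inr (h₁ _)

/-- The non-retractions onto a nonzero object satisfying the local endomorphism dichotomy
form a subspace. -/
def nonRetractions (k : Type*) [Field k] [Linear k 𝒜] (Z : 𝒜) {W : 𝒜} (hW₀ : ¬ IsZero W)
    (hW : ∀ e : W ⟶ W, IsIso e ∨ IsIso (𝟙 W - e)) : Submodule k (Z ⟶ W) where
  carrier := {g | ¬ IsSplitEpi g}
  zero_mem' := fun ⟨⟨s⟩⟩ ↦ hW₀ <| by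
    rw [IsZero.iff_id_eq_zero, ← s.id, comp_zero]
  add_mem' := by
    rintro f g hf hg ⟨⟨s⟩⟩
    have hs : 𝟙 W - s.section_ ≫ f = s.section_ ≫ g := by
      rw [← s.id, Preadditive.comp_add, add_sub_cancel_left]
    rcases hW (s.section_ ≫ f) with h | h
    · exact hf ⟨⟨⟨inv (s.section_ ≫ f) ≫ s.section_, by simp⟩⟩⟩
    · rw [hs] at h
      exact hg ⟨⟨⟨inv (s.section_ ≫ g) ≫ s.section_, by simp⟩⟩⟩
  smul_mem' := by
    rintro c g hg ⟨⟨s⟩⟩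
    exact hg ⟨⟨⟨c • s.section_, by
      rw [Linear.smul_comp, ← Linear.comp_smul]; exact s.id⟩⟩⟩

/-- A linear functional outside a subspace of the dual is detected by a vector which the
subspace annihilates. -/
lemma exists_apply_ne_zero_of_notMem {k V : Type*} [Field k] [AddCommGroup V] [Module k V]
    [FiniteDimensional k V] (U : Submodule k (Module.Dual k V)) {f : Module.Dual k V}
    (hf : f ∉ U) : ∃ x, (∀ g ∈ U, g x = 0) ∧ f x ≠ 0 := by
  rw [← Subspace.dualCoannihilator_dualAnnihilator_eq (W := U),
    Submodule.mem_dualAnnihilator] at hf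
  push Not at hf
  obtain ⟨x, hx, hfx⟩ := hf
  exact ⟨x, (Submodule.mem_dualCoannihilator x).1 hx, hfx⟩

/-- If `ψ : Hom(Z, -) → D Ext¹(-, Y)` is surjective with kernel the projective morphisms, there is
an almost split sequence starting at the indecomposable object `Y`. -/
lemma existsAlmostSplitStartingAt_of_surjective {k : Type*} [Field k] [Linear k 𝒜] [HasExt.{w} 𝒜]
    (extFin : ∀ A B : 𝒜, FiniteDimensional k (Abelian.Ext A B 1))
    (hKS : IsKrullSchmidtCat 𝒜) {Y : 𝒜} (hY : Indec Y) (hYni : ¬ IsExtInjective Y) {Z : 𝒜}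
    (ψ : ∀ M : 𝒜, (Z ⟶ M) →ₗ[k] (Abelian.Ext M Y 1 →ₗ[k] k))
    (hsurj : ∀ M : 𝒜, Function.Surjective (ψ M))
    (hker : ∀ (M : 𝒜) (g : Z ⟶ M), ψ M g = 0 ↔ IsProjMorphism g)
    (hnat : ∀ (M M' : 𝒜) (u : M ⟶ M') (g : Z ⟶ M) (μ' : Abelian.Ext M' Y 1),
      ψ M' (g ≫ u) μ' = ψ M g ((Abelian.Ext.mk₀ u).comp μ' (zero_add 1))) :
    ExistsAlmostSplitStartingAt Y := by
  have hsep {M : 𝒜} {μ : Abelian.Ext M Y 1} (hμ : μ ≠ 0) : ∃ g : Z ⟶ M, ψ M g μ ≠ 0 := by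
    by_contra! h
    refine hμ ((Module.forall_dual_apply_eq_zero_iff k μ).1 fun f ↦ ?_)
    obtain ⟨g, rfl⟩ := hsurj M f
    exact h g
  have hZ : ¬ IsExtProjective Z := fun hZ ↦ hYni fun M μ ↦ by
    by_contra hμ
    obtain ⟨g, hg⟩ := hsep hμ
    exact hg (by rw [(hker M g).2 fun A δ ↦ hZ A _, LinearMap.zero_apply])
  obtain ⟨n, W, ⟨α⟩, hloc⟩ := hKS Z
  obtain ⟨j, hj⟩ : ∃ j, ¬ IsExtProjective (W j) := by
    by_contra! h
    exact hZ (isExtProjective_of_iso_biproduct α h)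
  have := hloc j
  have hW₀ : ¬ IsZero (W j) := fun h ↦ one_ne_zero (α := End (W j)) (h.eq_of_src _ _)
  let R := nonRetractions k Z hW₀ isIso_or_isIso_one_sub_of_isLocalRing
  let π : Z ⟶ W j := α.hom ≫ biproduct.π W j
  have hπ : IsSplitEpi π := ⟨⟨⟨biproduct.ι W j ≫ α.inv, by simp [π]⟩⟩⟩
  have hπR : ψ (W j) π ∉ R.map (ψ (W j)) := by
    rintro ⟨g, hg, hgπ⟩
    have hproj : IsProjMorphism (π - g) := by rw [← hker, map_sub, hgπ, sub_self]
    have hsub : π - g ∈ R := fun _ ↦ hj hproj.isExtProjective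
    have hmem : π ∈ R := sub_add_cancel π g ▸ R.add_mem hsub hg
    exact hmem hπ
  obtain ⟨η, hηR, hηπ⟩ := exists_apply_ne_zero_of_notMem (R.map (ψ (W j))) hπR
  have hη₀ : η ≠ 0 := by
    rintro rfl
    exact hηπ (map_zero _)
  have hright (Y' : 𝒜) (c : Y' ⟶ W j) (hc : ¬ IsSplitEpi c) :
      (Abelian.Ext.mk₀ c).comp η (zero_add 1) = 0 := by
    by_contra h
    obtain ⟨g, hg⟩ := hsep h
    rw [← hnat] at hg
    refine hg (hηR _ (Submodule.mem_map_of_mem fun ⟨⟨s⟩⟩ ↦ hc ?_))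
    exact ⟨⟨⟨s.section_ ≫ g, by rw [Category.assoc, s.id]⟩⟩⟩
  have hleft := comp_mk₀_eq_zero_of_not_isSplitMono (hY.isIso_or_isIso_one_sub hKS) hη₀ hright
  obtain ⟨E, i, p, w, hS, rfl⟩ := exists_shortExact_extClass_eq η
  exact ⟨W j, E, i, p, w, hS, hη₀, hleft, hright⟩

section Pairing

variable {k : Type*} [Field k] [Linear k 𝒜] [HasExt.{w} 𝒜]

lemma mk₀_smul_comp {X Y Z : 𝒜} (r : k) (g : X ⟶ Y) (μ : Abelian.Ext Y Z 1) :
    (Abelian.Ext.mk₀ (r • g)).comp μ (zero_add 1) =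
      r • (Abelian.Ext.mk₀ g).comp μ (zero_add 1) := by
  change _ = (Abelian.Ext.mk₀ (r • 𝟙 X)).comp _ (zero_add 1)
  rw [Abelian.Ext.mk₀_comp_mk₀_assoc, Linear.smul_comp, Category.id_comp]

lemma mk₀_comp_smul {X Y Z : 𝒜} (r : k) (g : X ⟶ Y) (μ : Abelian.Ext Y Z 1) :
    (Abelian.Ext.mk₀ g).comp (r • μ) (zero_add 1) =
      r • (Abelian.Ext.mk₀ g).comp μ (zero_add 1) := by
  rw [← mk₀_smul_comp]
  change (Abelian.Ext.mk₀ g).comp ((Abelian.Ext.mk₀ (r • 𝟙 Y)).comp μ _) _ = _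
  rw [Abelian.Ext.mk₀_comp_mk₀_assoc, Linear.comp_smul, Category.comp_id]

/-- The pairing `Hom(Z, M) × Ext¹(M, Y) → k` induced by a linear functional on `Ext¹(Z, Y)`. -/
noncomputable def extPairing {Z Y : 𝒜} (φ : Abelian.Ext Z Y 1 →ₗ[k] k) (M : 𝒜) :
    (Z ⟶ M) →ₗ[k] (Abelian.Ext M Y 1 →ₗ[k] k) :=
  LinearMap.mk₂ k (fun g μ ↦ φ ((Abelian.Ext.mk₀ g).comp μ (zero_add 1)))
    (fun g g' μ ↦ by rw [Abelian.Ext.mk₀_add, Abelian.Ext.add_comp, map_add])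
    (fun r g μ ↦ by rw [mk₀_smul_comp, map_smul])
    (fun g μ μ' ↦ by rw [Abelian.Ext.comp_add, map_add])
    (fun r g μ ↦ by rw [mk₀_comp_smul, map_smul])

@[simp]
lemma extPairing_apply {Z Y : 𝒜} (φ : Abelian.Ext Z Y 1 →ₗ[k] k) {M : 𝒜} (g : Z ⟶ M)
    (μ : Abelian.Ext M Y 1) :
    extPairing φ M g μ = φ ((Abelian.Ext.mk₀ g).comp μ (zero_add 1)) := rfl

end Pairing

/-- `Y ∈ 𝒜_l` iff there is an almost split sequence starting at `Y`. -/
theorem statement_6 {k : Type*} [Field k] [Linear k 𝒜] [HasExt.{w} 𝒜]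
    (homFin : ∀ A B : 𝒜, FiniteDimensional k (A ⟶ B))
    (extFin : ∀ A B : 𝒜, FiniteDimensional k (Abelian.Ext A B 1))
    (hKS : IsKrullSchmidtCat 𝒜)
    {Y : 𝒜} (hY : Indec Y) (hYni : ¬ IsExtInjective Y) :
    (∃ (Z : 𝒜) (ψ : ∀ M : 𝒜, (Z ⟶ M) →ₗ[k] (Abelian.Ext M Y 1 →ₗ[k] k)),
        (∀ M : 𝒜, Function.Surjective (ψ M)) ∧
        (∀ (M : 𝒜) (g : Z ⟶ M), ψ M g = 0 ↔ IsProjMorphism g) ∧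
        (∀ (M M' : 𝒜) (u : M ⟶ M') (g : Z ⟶ M) (μ' : Abelian.Ext M' Y 1),
          ψ M' (g ≫ u) μ' = ψ M g ((Abelian.Ext.mk₀ u).comp μ' (zero_add 1)))) ↔
      ExistsAlmostSplitStartingAt Y := by
  constructor
  · rintro ⟨Z, ψ, hsurj, hker, hnat⟩
    exact existsAlmostSplitStartingAt_of_surjective extFin hKS hY hYni ψ hsurj hker hnat
  · rintro ⟨Z, E, i, p, w, hS, hη₀, hleft, hright⟩
    obtain ⟨φ, hφ⟩ : ∃ φ : Abelian.Ext Z Y 1 →ₗ[k] k, φ hS.extClass ≠ 0 := by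
      by_contra! h
      exact hη₀ ((Module.forall_dual_apply_eq_zero_iff k _).1 h)
    refine ⟨Z, extPairing φ, fun M f ↦ ?_, fun M g ↦ ⟨fun hg A δ ↦ ?_, fun hg ↦ ?_⟩, ?_⟩
    · by_contra hf
      obtain ⟨μ, hμ, hfμ⟩ := exists_apply_ne_zero_of_notMem (LinearMap.range (extPairing φ M)) hf
      have hμ₀ : μ ≠ 0 := by
        rintro rfl
        exact hfμ (map_zero f)
      obtain ⟨g, hg⟩ := exists_mk₀_comp_eq hμ₀ hleft
      refine hφ ?_
      have h := hμ _ ⟨g, rfl⟩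
      rwa [extPairing_apply, hg] at h
    · by_contra hε
      obtain ⟨b, hb⟩ := exists_comp_mk₀_eq hε hright
      rw [Abelian.Ext.comp_assoc_of_third_deg_zero] at hb
      have h := LinearMap.congr_fun hg (δ.comp (Abelian.Ext.mk₀ b) (add_zero 1))
      rw [extPairing_apply, hb] at h
      exact hφ h
    · ext μ
      rw [extPairing_apply, hg Y μ, map_zero, LinearMap.zero_apply]
    · intro M M' u g μ'
      rw [extPairing_apply, extPairing_apply, Abelian.Ext.mk₀_comp_mk₀_assoc]
end

section
/- Let 𝒜 be an abelian category and let (a,b,c) be a morphism of short exact sequences from 0 → A → x → B → y → C → 0 (with extension class δ ∈ Ext¹(C,A)) to 0 → A' → x' → B' → y' → C' → 0, i.e. a: A → A', b: B → B', c: C → C' with b∘x = x'∘a and c∘y = y'∘b. Then the following are equivalent: (1) a factors through x; (2) the pushout class a_*δ ∈ Ext¹(C,A') is zero; (3) c factors through y'. -/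
/- Preliminary definitions: the abelian-category instance of the extriangulated
notions of the paper (s-projective/injective morphisms and objects, almost split
short exact sequences, morphisms determined by objects, etc.). -/

open CategoryTheory CategoryTheory.Limits

attribute [local instance] CategoryTheory.Abelian.hasFiniteBiproducts

universe w v u

variable {𝒜 : Type u} [Category.{v} 𝒜] [Abelian 𝒜]

/-- for a morphism of short exact sequences, `a` factors through `x`
iff the pushout class `a_*δ` vanishes iff `c` factors through `y'`. -/
theorem statement_7 [HasExt.{w} 𝒜] {S S' : ShortComplex 𝒜}
    (hS : S.ShortExact) (hS' : S'.ShortExact)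
    (a : S.X₁ ⟶ S'.X₁) (b : S.X₂ ⟶ S'.X₂) (c : S.X₃ ⟶ S'.X₃)
    (comm₁ : S.f ≫ b = a ≫ S'.f) (comm₂ : S.g ≫ c = b ≫ S'.g) :
    List.TFAE [
      ∃ t : S.X₂ ⟶ S'.X₁, S.f ≫ t = a,
      hS.extClass.comp (Abelian.Ext.mk₀ a) (add_zero 1) = 0,
      ∃ s : S.X₃ ⟶ S'.X₂, s ≫ S'.g = c] := by
  have nat : hS.extClass.comp (Abelian.Ext.mk₀ a) (add_zero 1) =
      (Abelian.Ext.mk₀ c).comp hS'.extClass (zero_add 1) :=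
    hS.extClass_naturality hS' ⟨a, b, c, comm₁.symm, comm₂.symm⟩
  tfae_have 1 → 2 := by
    rintro ⟨t, rfl⟩
    rw [← Abelian.Ext.mk₀_comp_mk₀, hS.extClass_comp_assoc]
  tfae_have 2 → 1 := by
    intro h
    obtain ⟨x, hx⟩ := Abelian.Ext.contravariant_sequence_exact₁ hS _ (Abelian.Ext.mk₀ a) rfl h
    obtain ⟨t, rfl⟩ := (Abelian.Ext.mk₀_bijective _ _).2 x
    rw [Abelian.Ext.mk₀_comp_mk₀] at hx
    exact ⟨t, (Abelian.Ext.mk₀_bijective _ _).1 hx⟩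
  tfae_have 3 → 2 := by
    rintro ⟨s, rfl⟩
    rw [nat, ← Abelian.Ext.mk₀_comp_mk₀, Abelian.Ext.comp_assoc (h₁₂ := zero_add 0)
      (h₂₃ := zero_add 1) (h := by simp), hS'.comp_extClass, Abelian.Ext.comp_zero]
  tfae_have 2 → 3 := by
    intro h
    rw [nat] at h
    obtain ⟨x, hx⟩ := Abelian.Ext.covariant_sequence_exact₃ _ hS' (Abelian.Ext.mk₀ c) rfl h
    obtain ⟨s, rfl⟩ := (Abelian.Ext.mk₀_bijective _ _).2 x
    rw [Abelian.Ext.mk₀_comp_mk₀] at hx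
    exact ⟨s, (Abelian.Ext.mk₀_bijective _ _).1 hx⟩
  tfae_finish
end

section
/- Let 𝒜 be an abelian category, and consider a morphism of short exact sequences from 0 → X → e' → Y' → f' → Z' → 0 to 0 → X → e → Y → f → Z → 0 whose components are (id_X, g', g), i.e. g': Y' → Y and g: Z' → Z satisfy g'∘e' = e and g∘f' = f∘g'. If f is right C-determined for some object C, then f' is also right C-determined. -/
/- Preliminary definitions: the abelian-category instance of the extriangulated
notions of the paper (s-projective/injective morphisms and objects, almost split
short exact sequences, morphisms determined by objects, etc.). -/

open CategoryTheory CategoryTheory.Limits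

attribute [local instance] CategoryTheory.Abelian.hasFiniteBiproducts

universe w v u

variable {𝒜 : Type u} [Category.{v} 𝒜] [Abelian 𝒜]

/-- In a morphism of short exact sequences which is the identity on the first terms, a morphism
into `Z'` lifts along `f'` as soon as its composite with `g` lifts along `f`. -/
theorem FactorsThru.of_comp_of_shortExact {X Y' Z' Y Z T : 𝒜}
    {e' : X ⟶ Y'} {f' : Y' ⟶ Z'} {e : X ⟶ Y} {f : Y ⟶ Z}
    {w' : e' ≫ f' = 0} {w : e ≫ f = 0}
    (hS' : (ShortComplex.mk e' f' w').ShortExact)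
    (hS : (ShortComplex.mk e f w).ShortExact)
    {g' : Y' ⟶ Y} {g : Z' ⟶ Z} (h₁ : e' ≫ g' = e) (h₂ : f' ≫ g = g' ≫ f)
    {p : T ⟶ Z'} (hp : FactorsThru (p ≫ g) f) : FactorsThru p f' := by
  obtain ⟨t, ht⟩ := hp
  have : Epi f' := hS'.epi_g
  have : Mono e := hS.mono_f
  have : Mono e' := hS'.mono_f
  let a : pullback f' p ⟶ Y' := pullback.fst f' p
  let b : pullback f' p ⟶ T := pullback.snd f' p
  have hab : a ≫ f' = b ≫ p := pullback.condition
  have hd : (a ≫ g' - b ≫ t) ≫ f = 0 := by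
    rw [Preadditive.sub_comp, Category.assoc, Category.assoc, ← h₂, ht, reassoc_of% hab, sub_self]
  obtain ⟨l, hl⟩ : ∃ l : pullback f' p ⟶ X, l ≫ e = a ≫ g' - b ≫ t :=
    ⟨hS.exact.lift _ hd, hS.exact.lift_f _ hd⟩
  have hk : (kernel.ι b ≫ (a - l ≫ e')) ≫ f' = 0 := by
    simp [hab, w']
  obtain ⟨n, hn⟩ : ∃ n : kernel b ⟶ X, n ≫ e' = kernel.ι b ≫ (a - l ≫ e') :=
    ⟨hS'.exact.lift _ hk, hS'.exact.lift_f _ hk⟩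
  have hne : n ≫ e = 0 := by
    rw [← h₁, reassoc_of% hn, Preadditive.sub_comp, Category.assoc, h₁, hl, sub_sub_cancel,
      kernel.condition_assoc, zero_comp]
  have hk₀ : kernel.ι b ≫ (a - l ≫ e') = 0 := by
    rw [← hn, zero_of_comp_mono e hne, zero_comp]
  refine ⟨Abelian.epiDesc b _ hk₀, ?_⟩
  rw [← cancel_epi b, Abelian.comp_epiDesc_assoc, Preadditive.sub_comp, Category.assoc, w',
    comp_zero, sub_zero, hab]

/-- right determination passes to pullback-type morphisms of short
exact sequences with identical first terms. -/
theorem statement_8 {C X Y' Z' Y Z : 𝒜}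
    (e' : X ⟶ Y') (f' : Y' ⟶ Z') (e : X ⟶ Y) (f : Y ⟶ Z)
    (w' : e' ≫ f' = 0) (w : e ≫ f = 0)
    (hS' : (ShortComplex.mk e' f' w').ShortExact)
    (hS : (ShortComplex.mk e f w).ShortExact)
    (g' : Y' ⟶ Y) (g : Z' ⟶ Z) (h₁ : e' ≫ g' = e) (h₂ : f' ≫ g = g' ≫ f)
    (hdet : RightDetermined C f) :
    RightDetermined C f' := by
  intro T p hp
  refine FactorsThru.of_comp_of_shortExact hS' hS h₁ h₂ (hdet T (p ≫ g) fun h ↦ ?_)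
  obtain ⟨t, ht⟩ := hp h
  exact ⟨t ≫ g', by rw [Category.assoc, ← h₂, reassoc_of% ht]⟩
end

section
/- Let 𝒜 be an abelian category, and consider a morphism of short exact sequences from 0 → X → e' → Y' → f' → Z' → 0 to 0 → X → e → Y → f → Z → 0 whose components are (id_X, g', g). If Z' is indecomposable with local endomorphism ring and g almost factors through f, then f' is right almost split. -/
/- Preliminary definitions: the abelian-category instance of the extriangulated
notions of the paper (s-projective/injective morphisms and objects, almost split
short exact sequences, morphisms determined by objects, etc.). -/

open CategoryTheory CategoryTheory.Limits

attribute [local instance] CategoryTheory.Abelian.hasFiniteBiproducts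

universe w v u

variable {𝒜 : Type u} [Category.{v} 𝒜] [Abelian 𝒜]

/-- In a local ring, an element with a left inverse has it as a right inverse too. -/
theorem mul_eq_one_comm_of_isLocalRing {R : Type*} [Ring R] [IsLocalRing R] {a b : R}
    (h : a * b = 1) : b * a = 1 := by
  have idem : b * a * (b * a) = b * a := by
    rw [mul_assoc, ← mul_assoc a, h, one_mul]
  rcases IsLocalRing.isUnit_or_isUnit_of_add_one (add_sub_cancel (b * a) 1) with hu | hu
  · exact hu.mul_left_cancel (by rw [idem, mul_one])
  · have h0 : b * a = 0 := hu.mul_left_cancel (by rw [sub_mul, one_mul, idem, sub_self, mul_zero])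
    have h1 : (1 : R) = 0 := by
      calc (1 : R) = a * (b * a) * b := by rw [← mul_assoc, h, one_mul, h]
        _ = 0 := by rw [h0, mul_zero, zero_mul]
    exact absurd h1 one_ne_zero

/-- In a local ring, an element without right inverse lies in the Jacobson radical. -/
theorem mem_jacobson_bot_of_isLocalRing {R : Type*} [Ring R] [IsLocalRing R] {x : R}
    (hx : ∀ b, x * b ≠ 1) : x ∈ (⊥ : Ideal R).jacobson := by
  refine Ideal.mem_jacobson_iff.2 fun y ↦ ?_
  have hyx : ¬ IsUnit (-(y * x)) := by
    rw [IsUnit.neg_iff]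
    intro hu
    obtain ⟨c, hc⟩ := hu.exists_left_inv
    rw [← mul_assoc] at hc
    exact hx _ (mul_eq_one_comm_of_isLocalRing hc)
  have hsum : -(y * x) + (y * x + 1) = 1 := neg_add_cancel_left _ _
  obtain ⟨z, hz⟩ :=
    ((IsLocalRing.isUnit_or_isUnit_of_add_one hsum).resolve_left hyx).exists_left_inv
  refine ⟨z, ?_⟩
  rw [Ideal.mem_bot, mul_assoc, sub_eq_zero, ← hz, mul_add, mul_one]

/-- A morphism to an object with local endomorphism ring that is not a split epimorphism
is in the radical. -/
theorem inRadical_of_not_isSplitEpi {T Z : 𝒜} [IsLocalRing (End Z)] {h : T ⟶ Z}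
    (hh : ¬ IsSplitEpi h) : InRadical h := fun u ↦
  mem_jacobson_bot_of_isLocalRing (R := End Z) fun b hb ↦
    hh ⟨⟨⟨b ≫ u, (Category.assoc _ _ _).trans hb⟩⟩⟩

/-- A morphism of short exact sequences which is the identity on the left terms has a
cartesian right-hand square. -/
theorem isPullback_of_shortExact {X Y' Z' Y Z : 𝒜}
    {e' : X ⟶ Y'} {f' : Y' ⟶ Z'} {e : X ⟶ Y} {f : Y ⟶ Z}
    {w' : e' ≫ f' = 0} {w : e ≫ f = 0}
    (hS' : (ShortComplex.mk e' f' w').ShortExact)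
    (hS : (ShortComplex.mk e f w).ShortExact)
    {g' : Y' ⟶ Y} {g : Z' ⟶ Z} (h₁ : e' ≫ g' = e) (h₂ : f' ≫ g = g' ≫ f) :
    IsPullback g' f' f g := by
  have : Mono e := hS.mono_f
  have : Mono e' := hS'.mono_f
  have : Epi f' := hS'.epi_g
  let φ : Y' ⟶ pullback f g := pullback.lift g' f' h₂.symm
  have hφ₁ : φ ≫ pullback.fst f g = g' := pullback.lift_fst _ _ _
  have hφ₂ : φ ≫ pullback.snd f g = f' := pullback.lift_snd _ _ _
  have : Mono φ := by
    refine Preadditive.mono_of_cancel_zero _ fun s hs ↦ ?_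
    have hsf : s ≫ f' = 0 := by rw [← hφ₂, reassoc_of% hs, zero_comp]
    have hsg : s ≫ g' = 0 := by rw [← hφ₁, reassoc_of% hs, zero_comp]
    obtain ⟨a, ha⟩ : ∃ a, a ≫ e' = s := ⟨_, hS'.exact.lift_f s hsf⟩
    have ha0 : a = 0 := by
      rw [← cancel_mono e, zero_comp, ← h₁, reassoc_of% ha, hsg]
    rw [← ha, ha0, zero_comp]
  have : Epi φ := by
    obtain ⟨A, π, hπ, y, hy⟩ := surjective_up_to_refinements_of_epi f' (pullback.snd f g)
    have hk : (π ≫ pullback.fst f g - y ≫ g') ≫ f = 0 := by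
      rw [Preadditive.sub_comp, Category.assoc, Category.assoc, ← h₂, pullback.condition,
        reassoc_of% hy, sub_self]
    obtain ⟨a, ha⟩ : ∃ a, a ≫ e = π ≫ pullback.fst f g - y ≫ g' := ⟨_, hS.exact.lift_f _ hk⟩
    have hlift : (y + a ≫ e') ≫ φ = π := by
      apply pullback.hom_ext
      · rw [Category.assoc, hφ₁, Preadditive.add_comp, Category.assoc, h₁, ha,
          add_sub_cancel]
      · rw [Category.assoc, hφ₂, Preadditive.add_comp, Category.assoc, w', comp_zero, add_zero, hy]
    exact epi_of_epi_fac hlift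
  have : IsIso φ := isIso_of_mono_of_epi φ
  exact IsPullback.of_iso_pullback ⟨h₂.symm⟩ (asIso φ) hφ₁ hφ₂

/-- if `g` almost factors through `f` and `Z'` is indecomposable with
local endomorphism ring, then `f'` is right almost split. -/
theorem statement_9 {X Y' Z' Y Z : 𝒜}
    (e' : X ⟶ Y') (f' : Y' ⟶ Z') (e : X ⟶ Y) (f : Y ⟶ Z)
    (w' : e' ≫ f' = 0) (w : e ≫ f = 0)
    (hS' : (ShortComplex.mk e' f' w').ShortExact)
    (hS : (ShortComplex.mk e f w).ShortExact)
    (g' : Y' ⟶ Y) (g : Z' ⟶ Z) (h₁ : e' ≫ g' = e) (h₂ : f' ≫ g = g' ≫ f)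
    (hZ' : Indec Z') (hloc : IsLocalRing (End Z'))
    (haf : AlmostFactorsThru g f) :
    RightAlmostSplit f' := by
  refine ⟨fun hsplit ↦ haf.1 ⟨section_ f' ≫ g', ?_⟩, fun B' h hh ↦ ?_⟩
  · rw [Category.assoc, ← h₂, IsSplitEpi.id_assoc]
  · obtain ⟨t, ht⟩ := haf.2 B' h (inRadical_of_not_isSplitEpi hh)
    have hp := isPullback_of_shortExact hS' hS h₁ h₂
    exact ⟨hp.lift t h ht, hp.lift_snd t h ht⟩
end
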